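/- Laplace mechanism: Let Lap(b), for b > 0, denote the probability measure on ℝ with density x ↦ (1/(2b))·exp(−|x|/b) with respect to Lebesgue measure (this is indeed a probability measure). Let X be a measurable space and f : (Fin n → X) → (Fin d → ℝ) have ℓ1-sensitivity at most S > 0, i.e. Σᵢ |f(D)(i) − f(D')(i)| ≤ S for all adjacent datasets D, D'. Then for every ε > 0 the mechanism outputting f(D) + Z, where Z has i.i.d. Lap(S/ε) coordinates (the pushforward of ⨂_{i ∈ Fin d} Lap(S/ε) under z ↦ f(D) + z), is (ε, 0)-differentially private. -/

import Mathlib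

open MeasureTheory ProbabilityTheory

/-- Two datasets are adjacent if they differ in at most one coordinate. -/
def Adjacent {X : Type*} {n : ℕ} (D D' : Fin n → X) : Prop :=
  ∃ i : Fin n, ∀ j : Fin n, j ≠ i → D j = D' j

/-- A mechanism `M` is `(ε, δ)`-differentially private w.r.t. one-coordinate
adjacency. -/
def IsDP {X : Type*} [MeasurableSpace X] {n : ℕ} {Ω : Type*} [MeasurableSpace Ω]
    (M : (Fin n → X) → Measure Ω) (ε δ : ℝ) : Prop :=
  ∀ D D' : Fin n → X, Adjacent D D' → ∀ A : Set Ω, MeasurableSet A →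
    M D A ≤ ENNReal.ofReal (Real.exp ε) * M D' A + ENNReal.ofReal δ

/-- The Laplace measure on `ℝ` with scale `b`, given by the density
`x ↦ (1/(2b))·exp(−|x|/b)` with respect to Lebesgue measure. -/
noncomputable def Lap (b : ℝ) : Measure ℝ :=
  volume.withDensity fun x => ENNReal.ofReal ((1 / (2 * b)) * Real.exp (-|x| / b))

/-- Product measures are monotone in their factors. -/
theorem measure_pi_mono {ι : Type*} [Fintype ι] {α : ι → Type*} [∀ i, MeasurableSpace (α i)]
    {μ ν : ∀ i, Measure (α i)} [∀ i, SigmaFinite (μ i)] (h : ∀ i, μ i ≤ ν i) :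
    Measure.pi μ ≤ Measure.pi ν := by
  refine Measure.le_iff.2 fun s hs => ?_
  rw [Measure.pi_def ν, toMeasure_apply _ _ hs]
  suffices (Measure.pi μ).toOuterMeasure ≤ OuterMeasure.pi fun i => (ν i).toOuterMeasure from
    this s
  rw [OuterMeasure.le_pi]
  intro t _
  exact (Measure.pi_pi μ t).le.trans (Finset.prod_le_prod' fun i _ => h i (t i))

/-- Scaling the factors of a product measure scales the product by the product of the scalars. -/
theorem measure_pi_smul {ι : Type*} [Fintype ι] {α : ι → Type*} [∀ i, MeasurableSpace (α i)]
    (μ : ∀ i, Measure (α i)) [∀ i, IsFiniteMeasure (μ i)] {c : ι → ENNReal}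
    (hc : ∀ i, c i ≠ ⊤) :
    Measure.pi (fun i => c i • μ i) = (∏ i, c i) • Measure.pi μ := by
  have (i : ι) : IsFiniteMeasure (c i • μ i) := Measure.smul_finite _ (hc i)
  refine Measure.pi_eq fun s _ => ?_
  simp [Finset.prod_mul_distrib]

/-- The Laplace measure of positive scale has total mass one. -/
theorem isProbabilityMeasure_lap {b : ℝ} (hb : 0 < b) : IsProbabilityMeasure (Lap b) := by
  have hneg : -(1 / b) < 0 := neg_lt_zero.2 (by positivity)
  have hint : ∫ x : ℝ, 1 / (2 * b) * Real.exp (-|x| / b) = 1 := by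
    rw [integral_comp_abs (f := fun x => 1 / (2 * b) * Real.exp (-x / b)), integral_const_mul]
    have h := integral_exp_mul_Ioi hneg 0
    have heq : (fun x : ℝ => Real.exp (-x / b)) = fun x => Real.exp (-(1 / b) * x) := by
      funext x
      congr 1
      ring
    rw [heq, h]
    simp
    field_simp
  refine ⟨?_⟩
  rw [Lap, withDensity_apply _ MeasurableSet.univ, Measure.restrict_univ,
    ← ofReal_integral_eq_lintegral_ofReal (.of_integral_ne_zero (by rw [hint]; exact one_ne_zero))
      (.of_forall fun x => by positivity), hint, ENNReal.ofReal_one]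

/-- A translate of the Laplace measure has the translated density. -/
theorem map_add_left_lap (b a : ℝ) :
    Measure.map (a + ·) (Lap b) = volume.withDensity fun x =>
      ENNReal.ofReal ((1 / (2 * b)) * Real.exp (-|x - a| / b)) := by
  have hm : Measurable (a + · : ℝ → ℝ) := measurable_const_add a
  ext s hs
  rw [Measure.map_apply hm hs, Lap, withDensity_apply _ (hm hs), withDensity_apply _ hs,
    ← (measurePreserving_add_left volume a).setLIntegral_comp_preimage hs (by fun_prop)]
  simp

/-- Two translates of the Laplace measure are within a factor exponential in their distance. -/
theorem map_add_left_lap_le {b : ℝ} (hb : 0 < b) (a a' : ℝ) :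
    Measure.map (a + ·) (Lap b) ≤
      ENNReal.ofReal (Real.exp (|a - a'| / b)) • Measure.map (a' + ·) (Lap b) := by
  rw [map_add_left_lap, map_add_left_lap, ← withDensity_smul _ (by fun_prop)]
  refine withDensity_mono (.of_forall fun x => ?_)
  rw [Pi.smul_apply, smul_eq_mul, ← ENNReal.ofReal_mul (Real.exp_pos _).le, mul_left_comm,
    ← Real.exp_add, ← add_div]
  have h : -|x - a| ≤ |a - a'| + -|x - a'| := by
    have := abs_sub_le x a a'
    linarith
  beta_reduce
  gcongr

/-- Two translates of a product of Laplace measures are within a factor exponential in the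
`ℓ1` distance of the translations. -/
theorem map_add_left_pi_lap_le {ι : Type*} [Fintype ι] {b : ℝ} (hb : 0 < b) (v w : ι → ℝ) :
    Measure.map (fun z : ι → ℝ => v + z) (Measure.pi fun _ => Lap b) ≤
      ENNReal.ofReal (Real.exp ((∑ i, |v i - w i|) / b)) •
        Measure.map (fun z : ι → ℝ => w + z) (Measure.pi fun _ => Lap b) := by
  have := isProbabilityMeasure_lap hb
  have hmap (u : ι → ℝ) : Measure.map (fun z : ι → ℝ => u + z) (Measure.pi fun _ => Lap b) =
      Measure.pi fun i => Measure.map (u i + ·) (Lap b) :=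
    Measure.pi_map_pi (f := fun i x => u i + x) fun i => (measurable_const_add _).aemeasurable
  rw [hmap, hmap, Finset.sum_div, Real.exp_sum,
    ENNReal.ofReal_prod_of_nonneg fun i _ => (Real.exp_pos _).le,
    ← measure_pi_smul _ fun i => ENNReal.ofReal_ne_top]
  exact measure_pi_mono fun i => map_add_left_lap_le hb (v i) (w i)

/-- Laplace mechanism: `Lap b` is a probability measure for `b > 0`, and adding
i.i.d. `Lap (S/ε)` noise to each coordinate of a `Fin d → ℝ`-valued query of
ℓ1-sensitivity `S` is `(ε, 0)`-differentially private. -/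
theorem laplace_mechanism
    {X : Type*} [MeasurableSpace X] {n d : ℕ}
    (f : (Fin n → X) → (Fin d → ℝ)) (S ε : ℝ) (hS : 0 < S) (hε : 0 < ε)
    (hsens : ∀ D D' : Fin n → X, Adjacent D D' →
      ∑ i, |f D i - f D' i| ≤ S) :
    IsProbabilityMeasure (Lap (S / ε)) ∧
    IsDP (fun D =>
      Measure.map (fun z : Fin d → ℝ => f D + z)
        (Measure.pi fun _ : Fin d => Lap (S / ε))) ε 0 := by
  have hb : 0 < S / ε := div_pos hS hε
  refine ⟨isProbabilityMeasure_lap hb, fun D D' hD A _ => ?_⟩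
  rw [ENNReal.ofReal_zero, add_zero]
  refine (map_add_left_pi_lap_le hb (f D) (f D') A).trans ?_
  rw [Measure.smul_apply, smul_eq_mul]
  gcongr
  rw [div_le_iff₀ hb, mul_div_cancel₀ _ hε.ne']
  exact hsens D D' hD
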